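/- For any θ > 0 there exists a function n: ℤ⁺ → ℤ⁺ and a sequence of finite connected graphs {G_g}_{g≥1} with all vertex degrees 1 or 3, such that G_g has 2g - 2 + n(g) vertices of degree 3 and n(g) vertices of degree 1, lim_{g→∞} n(g)/g = θ, and liminf_{g→∞} λ₁(G_g) ≥ 1/(648(θ+4)²). -/

import Mathlib

/-- Degree of a vertex, as the number of neighbours. -/
noncomputable def degN {V : Type*} (G : SimpleGraph V) (v : V) : ℕ := {w | G.Adj v w}.ncard

open Classical in
/-- The Dirichlet energy `Σ_{{x,y} ∈ E} (f x - f y)²` (each edge counted once). -/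
noncomputable def quadForm {V : Type*} [Fintype V] (G : SimpleGraph V) (f : V → ℝ) : ℝ :=
  (1 / 2) * ∑ v : V, ∑ w : V, if G.Adj v w then (f v - f w) ^ 2 else 0

/-- The degree-weighted square norm `Σ_v deg(v) f(v)²`. -/
noncomputable def lapNormSq {V : Type*} [Fintype V] (G : SimpleGraph V) (f : V → ℝ) : ℝ :=
  ∑ v : V, (degN G v : ℝ) * f v ^ 2

/-- The boundary square norm `Σ_{x ∈ δG} f(x)²`, where `δG` is the set of degree-1 vertices. -/
noncomputable def stekNormSq {V : Type*} [Fintype V] (G : SimpleGraph V) (f : V → ℝ) : ℝ :=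
  ∑ v : V, if degN G v = 1 then f v ^ 2 else 0

/-- The `k`-th eigenvalue of the normalized Laplacian, via the Courant–Fischer
min-max characterization. -/
noncomputable def lapEig {V : Type*} [Fintype V] (G : SimpleGraph V) (k : ℕ) : ℝ :=
  sInf {r : ℝ | ∃ W : Submodule ℝ (V → ℝ), Module.finrank ℝ W = k + 1 ∧
    ∀ f ∈ W, quadForm G f ≤ r * lapNormSq G f}

/-- The `k`-th Steklov eigenvalue of `(G, δG)`, via the min-max characterization. -/
noncomputable def stekEig {V : Type*} [Fintype V] (G : SimpleGraph V) (k : ℕ) : ℝ :=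
  sInf {r : ℝ | ∃ W : Submodule ℝ (V → ℝ), Module.finrank ℝ W = k + 1 ∧
    ∀ f ∈ W, quadForm G f ≤ r * stekNormSq G f}

section Aux

open Finset

/-- The torus grid. -/
abbrev Tor (m : ℕ) := ZMod m × ZMod m

/-- shear `(x,y) ↦ (x+2y,y)`. -/
def shX (m : ℕ) : Equiv.Perm (Tor m) where
  toFun p := (p.1 + 2 * p.2, p.2)
  invFun p := (p.1 - 2 * p.2, p.2)
  left_inv p := by simp
  right_inv p := by simp

/-- shear `(x,y) ↦ (x,y+2x)`. -/
def shY (m : ℕ) : Equiv.Perm (Tor m) where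
  toFun p := (p.1, p.2 + 2 * p.1)
  invFun p := (p.1, p.2 - 2 * p.1)
  left_inv p := by simp
  right_inv p := by simp

/-- translation `(x,y) ↦ (x+1,y)`. -/
def trX (m : ℕ) : Equiv.Perm (Tor m) where
  toFun p := (p.1 + 1, p.2)
  invFun p := (p.1 - 1, p.2)
  left_inv p := by simp
  right_inv p := by simp

/-- translation `(x,y) ↦ (x,y+1)`. -/
def trY (m : ℕ) : Equiv.Perm (Tor m) where
  toFun p := (p.1, p.2 + 1)
  invFun p := (p.1, p.2 - 1)
  left_inv p := by simp
  right_inv p := by simp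

/-- the pairing character -/
noncomputable def chi {m : ℕ} [NeZero m] (ξ z : Tor m) : ℂ :=
  ZMod.stdAddChar (ξ.1 * z.1 + ξ.2 * z.2)

/-- Fourier transform on the torus grid. -/
noncomputable def fhat {m : ℕ} [NeZero m] (F : Tor m → ℝ) (ξ : Tor m) : ℂ :=
  ∑ z, (F z : ℂ) * chi ξ z

lemma chi_sum {m : ℕ} [NeZero m] (d : Tor m) :
    ∑ ξ : Tor m, chi ξ d = if d = 0 then (m : ℂ) ^ 2 else 0 := by
  classical
  have h1 := fun b => AddChar.sum_mulShift (R := ZMod m) b (ZMod.isPrimitive_stdAddChar m)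
  rw [Fintype.sum_prod_type]
  simp only [chi, AddChar.map_add_eq_mul, ← Finset.mul_sum, ← Finset.sum_mul, h1]
  rcases d with ⟨a, b⟩
  simp only [Prod.mk_eq_zero, ZMod.card]
  by_cases ha : a = 0 <;> by_cases hb : b = 0 <;> simp [ha, hb, sq]

lemma chi_conj {m : ℕ} [NeZero m] (ξ z w : Tor m) :
    chi ξ z * (starRingEnd ℂ) (chi ξ w) = chi ξ (z - w) := by
  have h : (starRingEnd ℂ) (chi ξ w) = chi ξ (-w) := by
    simp only [chi]
    rw [← AddChar.map_neg_eq_conj]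
    congr 1
    simp
    ring
  rw [h]
  simp only [chi, ← AddChar.map_add_eq_mul]
  congr 1
  simp
  ring

lemma parseval {m : ℕ} [NeZero m] (F : Tor m → ℝ) :
    ∑ ξ, ‖fhat F ξ‖ ^ 2 = (m : ℝ) ^ 2 * ∑ z, F z ^ 2 := by
  have key : ((∑ ξ, ‖fhat F ξ‖ ^ 2 : ℝ) : ℂ) = (((m : ℝ) ^ 2 * ∑ z, F z ^ 2 : ℝ) : ℂ) := by
    push_cast
    have : ∀ ξ, ((‖fhat F ξ‖ : ℂ)) ^ 2 = ∑ z, ∑ w, (F z : ℂ) * F w * chi ξ (z - w) := by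
      intro ξ
      rw [← Complex.mul_conj', fhat, map_sum, Finset.sum_mul_sum]
      refine Finset.sum_congr rfl fun z _ => Finset.sum_congr rfl fun w _ => ?_
      rw [← chi_conj, map_mul, Complex.conj_ofReal]
      ring
    simp only [this]
    rw [Finset.sum_comm]
    rw [Finset.mul_sum]
    refine Finset.sum_congr rfl fun z _ => ?_
    rw [Finset.sum_comm]
    simp only [← Finset.mul_sum, chi_sum, sub_eq_zero]
    simp
    ring
  exact_mod_cast key

lemma fhat_sub {m : ℕ} [NeZero m] (F G : Tor m → ℝ) (ξ : Tor m) :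
    fhat (fun z => F z - G z) ξ = fhat F ξ - fhat G ξ := by
  simp [fhat, sub_mul, Finset.sum_sub_distrib]

lemma fhat_comp {m : ℕ} [NeZero m] (F : Tor m → ℝ) (g : Equiv.Perm (Tor m)) (ξ : Tor m) :
    fhat (fun z => F (g z)) ξ = ∑ z, (F z : ℂ) * chi ξ (g.symm z) := by
  rw [fhat, ← Equiv.sum_comp g (fun z => (F z : ℂ) * chi ξ (g.symm z))]
  simp

lemma fhat_shX {m : ℕ} [NeZero m] (F : Tor m → ℝ) (ξ : Tor m) :
    fhat (fun z => F (shX m z)) ξ = fhat F ((shY m).symm ξ) := by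
  rw [fhat_comp, fhat]
  refine Finset.sum_congr rfl fun z _ => ?_
  simp only [chi, shX, shY, Equiv.coe_fn_symm_mk]
  congr 2
  ring

lemma fhat_shY {m : ℕ} [NeZero m] (F : Tor m → ℝ) (ξ : Tor m) :
    fhat (fun z => F (shY m z)) ξ = fhat F ((shX m).symm ξ) := by
  rw [fhat_comp, fhat]
  refine Finset.sum_congr rfl fun z _ => ?_
  simp only [chi, shX, shY, Equiv.coe_fn_symm_mk]
  congr 2
  ring

lemma fhat_trX {m : ℕ} [NeZero m] (F : Tor m → ℝ) (ξ : Tor m) :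
    fhat (fun z => F (trX m z)) ξ = ZMod.stdAddChar (-ξ.1) * fhat F ξ := by
  rw [fhat_comp, fhat, Finset.mul_sum]
  refine Finset.sum_congr rfl fun z _ => ?_
  simp only [chi, trX, Equiv.coe_fn_symm_mk]
  rw [show ξ.1 * (z.1 - 1) + ξ.2 * z.2 = -ξ.1 + (ξ.1 * z.1 + ξ.2 * z.2) by ring,
    AddChar.map_add_eq_mul]
  ring

lemma fhat_trY {m : ℕ} [NeZero m] (F : Tor m → ℝ) (ξ : Tor m) :
    fhat (fun z => F (trY m z)) ξ = ZMod.stdAddChar (-ξ.2) * fhat F ξ := by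
  rw [fhat_comp, fhat, Finset.mul_sum]
  refine Finset.sum_congr rfl fun z _ => ?_
  simp only [chi, trY, Equiv.coe_fn_symm_mk]
  rw [show ξ.1 * z.1 + ξ.2 * (z.2 - 1) = -ξ.2 + (ξ.1 * z.1 + ξ.2 * z.2) by ring,
    AddChar.map_add_eq_mul]
  ring

/-- absolute value of the minimal representative -/
def nrm {m : ℕ} (a : ZMod m) : ℕ := a.valMinAbs.natAbs

lemma norm_one_sub_char {m : ℕ} [NeZero m] (a : ZMod m) :
    ‖1 - (ZMod.stdAddChar (-a) : ℂ)‖ ^ 2 = 4 * Real.sin (Real.pi * nrm a / m) ^ 2 := by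
  have hm : (m : ℝ) ≠ 0 := by exact_mod_cast NeZero.ne m
  have h1 : (ZMod.stdAddChar (-a) : ℂ)
      = Complex.exp (Complex.I * ((-(2 * Real.pi * a.valMinAbs / m) : ℝ) : ℂ)) := by
    conv_lhs => rw [← ZMod.coe_valMinAbs a, ← Int.cast_neg, ZMod.stdAddChar_coe]
    congr 1
    push_cast
    ring
  rw [norm_sub_rev, h1, Complex.norm_exp_I_mul_ofReal_sub_one]
  have h2 : Real.sin (Real.pi * nrm a / m) ^ 2 = Real.sin (Real.pi * a.valMinAbs / m) ^ 2 := by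
    have : (nrm a : ℝ) = |(a.valMinAbs : ℝ)| := by
      simp [nrm, Nat.cast_natAbs]
    rw [this]
    rcases abs_choice (a.valMinAbs : ℝ) with h | h <;> rw [h]
    rw [show Real.pi * -(a.valMinAbs : ℝ) / m = -(Real.pi * a.valMinAbs / m) by ring, Real.sin_neg]
    ring
  rw [h2, show -(2 * Real.pi * (a.valMinAbs : ℝ) / m) / 2 = -(Real.pi * a.valMinAbs / m) by ring,
    Real.sin_neg, Real.norm_eq_abs, sq_abs]
  ring

lemma sin_far {m : ℕ} [NeZero m] (a b : ZMod m) (h : m ≤ 2 * (nrm a + nrm b)) :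
    1 ≤ Real.sin (Real.pi * nrm a / m) ^ 2 + Real.sin (Real.pi * nrm b / m) ^ 2 := by
  have hm : (0 : ℝ) < m := by exact_mod_cast NeZero.pos m
  have ha : 2 * nrm a ≤ m := by have := ZMod.natAbs_valMinAbs_le a; unfold nrm; omega
  have hb : 2 * nrm b ≤ m := by have := ZMod.natAbs_valMinAbs_le b; unfold nrm; omega
  have ha' : 2 * (nrm a : ℝ) ≤ m := by exact_mod_cast ha
  have hb' : 2 * (nrm b : ℝ) ≤ m := by exact_mod_cast hb
  have h' : (m : ℝ) ≤ 2 * (nrm a + nrm b) := by exact_mod_cast h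
  have hp := Real.pi_pos
  have key : Real.cos (Real.pi * nrm a / m) ≤ Real.sin (Real.pi * nrm b / m) := by
    rw [← Real.sin_pi_div_two_sub]
    apply Real.sin_le_sin_of_le_of_le_pi_div_two
    · have : Real.pi * nrm a / m ≤ Real.pi / 2 := by
        rw [div_le_div_iff₀ hm two_pos]; nlinarith
      linarith
    · rw [div_le_div_iff₀ hm two_pos]; nlinarith
    · rw [sub_le_iff_le_add, ← add_div, div_le_div_iff₀ two_pos hm]; nlinarith
  have hc : 0 ≤ Real.cos (Real.pi * nrm a / m) := by
    apply Real.cos_nonneg_of_mem_Icc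
    constructor
    · have : 0 ≤ Real.pi * nrm a / m := by positivity
      linarith
    · rw [div_le_div_iff₀ hm two_pos]; nlinarith
  have := Real.sin_sq_add_cos_sq (Real.pi * nrm a / m)
  nlinarith

/-- size of a frequency -/
def siz {m : ℕ} (ξ : Tor m) : ℕ := nrm ξ.1 + nrm ξ.2

/-- comparison weights -/
noncomputable def gam {m : ℕ} (a b : Tor m) : ℝ :=
  if siz a < siz b then 4 / 5 else if siz b < siz a then 5 / 4 else 1

lemma gam_pos {m : ℕ} (a b : Tor m) : 0 < gam a b := by
  unfold gam; split_ifs <;> norm_num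

lemma gam_le {m : ℕ} (a b : Tor m) : gam a b ≤ 5 / 4 := by
  unfold gam; split_ifs <;> norm_num

lemma gam_mul {m : ℕ} (a b : Tor m) : gam a b * gam b a = 1 := by
  unfold gam; split_ifs <;> first | (exfalso; omega) | norm_num

lemma gam_cs {m : ℕ} (a b : Tor m) (x y : ℝ) :
    2 * (x * y) ≤ gam a b * x ^ 2 + gam b a * y ^ 2 := by
  have h := gam_mul a b
  have hp := gam_pos a b
  have hq : gam b a = (gam a b)⁻¹ := by field_simp; linarith
  rw [hq]
  have : 0 ≤ (gam a b * x - y) ^ 2 / gam a b := by positivity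
  have h2 : (gam a b * x - y) ^ 2 / gam a b
      = gam a b * x ^ 2 + (gam a b)⁻¹ * y ^ 2 - 2 * (x * y) := by
    field_simp
    ring
  linarith

lemma rep_add {m : ℕ} [NeZero m] (a b : ZMod m) (s : ℤ) :
    ∃ k : ℤ, (a + (s : ZMod m) * b).valMinAbs = a.valMinAbs + s * b.valMinAbs + k * m := by
  have : (((a + (s : ZMod m) * b).valMinAbs - (a.valMinAbs + s * b.valMinAbs) : ℤ) : ZMod m) = 0 := by
    push_cast
    simp
  rw [ZMod.intCast_zmod_eq_zero_iff_dvd] at this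
  obtain ⟨k, hk⟩ := this
  exact ⟨k, by linarith⟩

lemma nrm_shift {m : ℕ} [NeZero m] (a b : ZMod m) (h : 2 * (nrm a + nrm b) < m) :
    (nrm (a + 2 * b) = (a.valMinAbs + 2 * b.valMinAbs).natAbs ∨
      nrm (a + 2 * b) = m - (a.valMinAbs + 2 * b.valMinAbs).natAbs) ∧
    (nrm (a - 2 * b) = (a.valMinAbs - 2 * b.valMinAbs).natAbs ∨
      nrm (a - 2 * b) = m - (a.valMinAbs - 2 * b.valMinAbs).natAbs) := by
  have key : ∀ s : ℤ, (s = 2 ∨ s = -2) → 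
    (nrm (a + (s : ZMod m) * b) = (a.valMinAbs + s * b.valMinAbs).natAbs ∨
      nrm (a + (s : ZMod m) * b) = m - (a.valMinAbs + s * b.valMinAbs).natAbs) := by
    intro s hs
    obtain ⟨k, hk⟩ := rep_add a b s
    have hb := ZMod.valMinAbs_mem_Ioc (a + (s : ZMod m) * b)
    rw [Set.mem_Ioc] at hb
    unfold nrm at *
    rw [hk] at hb ⊢
    set x := a.valMinAbs
    set y := b.valMinAbs
    have hm : (0 : ℤ) < m := by exact_mod_cast NeZero.pos m
    have hs1 : |x + s * y| < m := by
      rcases hs with rfl | rfl <;> · rw [abs_lt]; omega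
    rw [abs_lt] at hs1
    have k1 : k < 2 := by by_contra hh; push Not at hh; nlinarith
    have k2 : -2 < k := by by_contra hh; push Not at hh; nlinarith
    generalize x + s * y = z at *
    obtain rfl | rfl | rfl : k = -1 ∨ k = 0 ∨ k = 1 := by omega
    all_goals omega
  have h1 := key 2 (Or.inl rfl)
  have h2 := key (-2) (Or.inr rfl)
  constructor
  · simpa using h1
  · simpa [sub_eq_add_neg] using h2

lemma shift_arith (x y : ℤ) (m n1 n2 : ℕ) (h : 2 * (x.natAbs + y.natAbs) < m)
    (h1 : n1 = (x + 2 * y).natAbs ∨ n1 = m - (x + 2 * y).natAbs)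
    (h2 : n2 = (x - 2 * y).natAbs ∨ n2 = m - (x - 2 * y).natAbs) :
    (x.natAbs < y.natAbs → x.natAbs < n1 ∧ x.natAbs < n2) ∧
    (x.natAbs = y.natAbs → x.natAbs ≤ n1 ∧ x.natAbs ≤ n2) ∧
    (y = 0 → x.natAbs ≤ n1 ∧ x.natAbs ≤ n2) ∧
    (y ≠ 0 → x.natAbs < n1 ∨ x.natAbs < n2) := by
  refine ⟨?_, ?_, ?_, ?_⟩
  · intro; omega
  · intro; omega
  · intro; omega
  · intro; omega

lemma gam_near {m : ℕ} [NeZero m] (ξ : Tor m) (h0 : ξ ≠ 0) (h : 2 * (nrm ξ.1 + nrm ξ.2) < m) :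
    gam ξ (shX m ξ) + gam ξ ((shX m).symm ξ) + gam ξ (shY m ξ) + gam ξ ((shY m).symm ξ)
      ≤ 73 / 20 := by
  obtain ⟨a, b⟩ := ξ
  simp only at h
  have h1 := nrm_shift a b h
  have h2 := nrm_shift b a (by omega)
  have h0' : a.valMinAbs ≠ 0 ∨ b.valMinAbs ≠ 0 := by
    by_contra hh
    push Not at hh
    rw [ZMod.valMinAbs_eq_zero, ZMod.valMinAbs_eq_zero] at hh
    exact h0 (by simp [hh])
  have e1 : siz (shX m (a, b)) = nrm (a + 2 * b) + nrm b := rfl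
  have e2 : siz ((shX m).symm (a, b)) = nrm (a - 2 * b) + nrm b := rfl
  have e3 : siz (shY m (a, b)) = nrm a + nrm (b + 2 * a) := rfl
  have e4 : siz ((shY m).symm (a, b)) = nrm a + nrm (b - 2 * a) := rfl
  have e0 : siz ((a, b) : Tor m) = nrm a + nrm b := rfl
  have lt : ∀ η : Tor m, siz ((a, b) : Tor m) < siz η → gam (a, b) η = 4 / 5 := by
    intro η hη; simp [gam, hη]
  have le : ∀ η : Tor m, siz ((a, b) : Tor m) ≤ siz η → gam (a, b) η ≤ 1 := by
    intro η hη; unfold gam; split_ifs <;> first | (exfalso; omega) | norm_num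
  have l1 := gam_le (a, b) (shX m (a, b))
  have l2 := gam_le (a, b) ((shX m).symm (a, b))
  have l3 := gam_le (a, b) (shY m (a, b))
  have l4 := gam_le (a, b) ((shY m).symm (a, b))
  have t1 := lt (shX m (a, b))
  have t2 := lt ((shX m).symm (a, b))
  have t3 := lt (shY m (a, b))
  have t4 := lt ((shY m).symm (a, b))
  have s1 := le (shX m (a, b))
  have s2 := le ((shX m).symm (a, b))
  have s3 := le (shY m (a, b))
  have s4 := le ((shY m).symm (a, b))
  rw [e0, e1] at t1 s1
  rw [e0, e2] at t2 s2
  rw [e0, e3] at t3 s3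
  rw [e0, e4] at t4 s4
  generalize gam (a, b) (shX m (a, b)) = g1 at *
  generalize gam (a, b) ((shX m).symm (a, b)) = g2 at *
  generalize gam (a, b) (shY m (a, b)) = g3 at *
  generalize gam (a, b) ((shY m).symm (a, b)) = g4 at *
  generalize nrm (a + 2 * b) = n1 at *
  generalize nrm (a - 2 * b) = n2 at *
  generalize nrm (b + 2 * a) = n3 at *
  generalize nrm (b - 2 * a) = n4 at *
  unfold nrm at *
  generalize a.valMinAbs = x at *
  generalize b.valMinAbs = y at *
  clear e0 e1 e2 e3 e4 h0 lt le
  obtain ⟨a1, a2, a3, a4⟩ := shift_arith x y m n1 n2 h h1.1 h1.2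
  obtain ⟨b1, b2, b3, b4⟩ := shift_arith y x m n3 n4 (by omega) h2.1 h2.2
  clear h1 h2 h
  rcases lt_trichotomy x.natAbs y.natAbs with hc | hc | hc
  · obtain ⟨a1, a2⟩ := a1 hc
    rw [t1 (by omega), t2 (by omega)]
    by_cases hx : x = 0
    · obtain ⟨b1, b2⟩ := b3 hx
      have := s3 (by omega)
      have := s4 (by omega)
      linarith
    · rcases b4 hx with h | h
      · rw [t3 (by omega)]; linarith
      · rw [t4 (by omega)]; linarith
  · have hx : x ≠ 0 := by omega
    have hy : y ≠ 0 := by omega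
    obtain ⟨a1, a2⟩ := a2 hc
    obtain ⟨b1, b2⟩ := b2 hc.symm
    have := s1 (by omega)
    have := s2 (by omega)
    have := s3 (by omega)
    have := s4 (by omega)
    rcases a4 hy with h | h <;> rcases b4 hx with h' | h'
    · rw [t1 (by omega), t3 (by omega)]; linarith
    · rw [t1 (by omega), t4 (by omega)]; linarith
    · rw [t2 (by omega), t3 (by omega)]; linarith
    · rw [t2 (by omega), t4 (by omega)]; linarith
  · obtain ⟨b1, b2⟩ := b1 hc
    rw [t3 (by omega), t4 (by omega)]
    by_cases hy : y = 0
    · obtain ⟨a1, a2⟩ := a3 hy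
      have := s1 (by omega)
      have := s2 (by omega)
      linarith
    · rcases a4 hy with h | h
      · rw [t1 (by omega)]; linarith
      · rw [t2 (by omega)]; linarith

lemma gap_fourier {m : ℕ} [NeZero m] (G : Tor m → ℝ) (h0 : G 0 = 0) :
    7 / 20 * ∑ ξ, G ξ ^ 2 ≤
      ∑ ξ, (G ξ - G ((shX m).symm ξ)) ^ 2 + ∑ ξ, (G ξ - G ((shY m).symm ξ)) ^ 2
      + ∑ ξ : Tor m, (4 * Real.sin (Real.pi * nrm ξ.1 / m) ^ 2
        + 4 * Real.sin (Real.pi * nrm ξ.2 / m) ^ 2) * G ξ ^ 2 := by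
  have cs : ∀ g : Equiv.Perm (Tor m), ∑ ξ, (2 - gam ξ (g ξ) - gam ξ (g.symm ξ)) * G ξ ^ 2
      ≤ ∑ ξ, (G ξ - G (g.symm ξ)) ^ 2 := by
    intro g
    have e1 : ∑ ξ, gam ξ (g ξ) * G ξ ^ 2 = ∑ ξ, gam (g.symm ξ) ξ * G (g.symm ξ) ^ 2 := by
      rw [← Equiv.sum_comp g (fun ξ => gam (g.symm ξ) ξ * G (g.symm ξ) ^ 2)]
      simp
    have e2 : ∑ ξ, G ξ ^ 2 = ∑ ξ, G (g.symm ξ) ^ 2 :=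
      (Equiv.sum_comp g.symm (fun ξ => G ξ ^ 2)).symm
    have e3 : ∑ ξ, (2 - gam ξ (g ξ) - gam ξ (g.symm ξ)) * G ξ ^ 2
        = ∑ ξ, (G ξ ^ 2 + G (g.symm ξ) ^ 2 - gam (g.symm ξ) ξ * G (g.symm ξ) ^ 2
            - gam ξ (g.symm ξ) * G ξ ^ 2) := by
      simp only [Finset.sum_add_distrib, Finset.sum_sub_distrib, ← e1, ← e2, sub_mul,
        ← Finset.mul_sum]
      ring
    rw [e3]
    refine Finset.sum_le_sum fun ξ _ => ?_
    have := gam_cs ξ (g.symm ξ) (G ξ) (G (g.symm ξ))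
    nlinarith
  have c1 := cs (shX m)
  have c2 := cs (shY m)
  refine le_trans ?_ (add_le_add (add_le_add c1 c2) le_rfl)
  rw [← Finset.sum_add_distrib, ← Finset.sum_add_distrib, Finset.mul_sum]
  refine Finset.sum_le_sum fun ξ _ => ?_
  rw [← add_mul, ← add_mul]
  by_cases hξ : ξ = 0
  · simp [hξ, h0]
  refine mul_le_mul_of_nonneg_right ?_ (sq_nonneg _)
  by_cases hd : 2 * (nrm ξ.1 + nrm ξ.2) < m
  · have := gam_near ξ hξ hd
    nlinarith [sq_nonneg (Real.sin (Real.pi * nrm ξ.1 / m)),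
      sq_nonneg (Real.sin (Real.pi * nrm ξ.2 / m))]
  · have := sin_far ξ.1 ξ.2 (by omega)
    have := gam_le ξ (shX m ξ)
    have := gam_le ξ ((shX m).symm ξ)
    have := gam_le ξ (shY m ξ)
    have := gam_le ξ ((shY m).symm ξ)
    linarith

lemma torus_gap {m : ℕ} [NeZero m] (F : Tor m → ℝ) (h0 : ∑ z, F z = 0) :
    7 / 20 * ∑ z, F z ^ 2 ≤
      ∑ z, (F z - F (trX m z)) ^ 2 + ∑ z, (F z - F (trY m z)) ^ 2
      + ∑ z, (F z - F (shX m z)) ^ 2 + ∑ z, (F z - F (shY m z)) ^ 2 := by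
  have hm : (0 : ℝ) < (m : ℝ) ^ 2 := by
    have : (0 : ℝ) < m := by exact_mod_cast NeZero.pos m
    positivity
  have g := gap_fourier (fun ξ : Tor m => ‖fhat F ξ‖) (by
    have : fhat F 0 = 0 := by
      simp only [fhat, chi]
      simp
      exact_mod_cast h0
    simp [this])
  rw [parseval] at g
  have p1 := parseval (fun z => F z - F (trX m z))
  have p2 := parseval (fun z => F z - F (trY m z))
  have p3 := parseval (fun z => F z - F (shX m z))
  have p4 := parseval (fun z => F z - F (shY m z))
  simp only [fhat_sub F, fhat_trX, fhat_trY, fhat_shX, fhat_shY] at p1 p2 p3 p4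
  have e1 : ∀ (c d : ℂ), ‖d - c * d‖ ^ 2 = ‖1 - c‖ ^ 2 * ‖d‖ ^ 2 := by
    intro c d
    rw [← mul_pow, ← norm_mul]; congr 2; ring
  simp only [e1, norm_one_sub_char] at p1 p2
  have l3 : ∀ g : Equiv.Perm (Tor m), ∑ ξ, (‖fhat F ξ‖ - ‖fhat F (g ξ)‖) ^ 2
      ≤ ∑ ξ, ‖fhat F ξ - fhat F (g ξ)‖ ^ 2 := by
    intro g
    refine Finset.sum_le_sum fun ξ _ => ?_
    rw [← sq_abs]
    exact pow_le_pow_left₀ (abs_nonneg _) (abs_norm_sub_norm_le _ _) 2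
  have l1 := l3 (shX m).symm
  have l2 := l3 (shY m).symm
  simp only [add_mul, Finset.sum_add_distrib] at g
  have : (m : ℝ) ^ 2 * (7 / 20 * ∑ z, F z ^ 2) ≤ (m : ℝ) ^ 2 * (
      ∑ z, (F z - F (trX m z)) ^ 2 + ∑ z, (F z - F (trY m z)) ^ 2
      + ∑ z, (F z - F (shX m z)) ^ 2 + ∑ z, (F z - F (shY m z)) ^ 2) := by
    linarith
  exact le_of_mul_le_mul_left this hm


open Finset

/-- Poincare inequality off a hyperplane. -/
def Poinc {V : Type*} [Fintype V] (G : SimpleGraph V) (C : ℝ) : Prop :=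
  ∃ φ : (V → ℝ) →ₗ[ℝ] ℝ, ∀ f, φ f = 0 → lapNormSq G f ≤ C * quadForm G f

lemma lap_pos {V : Type*} [Fintype V] (G : SimpleGraph V) (hd : ∀ v, degN G v = 1 ∨ degN G v = 3)
    (f : V → ℝ) (hf : f ≠ 0) : 0 < lapNormSq G f := by
  obtain ⟨v, hv⟩ := Function.ne_iff.mp hf
  unfold lapNormSq
  refine Finset.sum_pos' (fun i _ => by positivity) ⟨v, Finset.mem_univ _, ?_⟩
  have : 0 < degN G v := by rcases hd v with h | h <;> omega
  have h2 : (0 : ℝ) < degN G v := by exact_mod_cast this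
  have h3 : 0 < f v ^ 2 := by
    have : f v ≠ 0 := hv
    positivity
  positivity

lemma quad_le {V : Type*} [Fintype V] (G : SimpleGraph V) (f : V → ℝ) :
    quadForm G f ≤ 2 * lapNormSq G f := by
  classical
  have hdeg : ∀ v, (degN G v : ℝ) = ∑ w, if G.Adj v w then (1 : ℝ) else 0 := by
    intro v
    rw [Finset.sum_boole, degN, Set.ncard_eq_toFinset_card']
    congr 2
    ext; simp
  have h1 : lapNormSq G f = ∑ v, ∑ w, if G.Adj v w then f v ^ 2 else 0 := by
    unfold lapNormSq
    refine Finset.sum_congr rfl fun v _ => ?_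
    rw [hdeg, Finset.sum_mul]
    refine Finset.sum_congr rfl fun w _ => ?_
    split_ifs <;> simp
  have h2 : lapNormSq G f = ∑ v, ∑ w, if G.Adj v w then f w ^ 2 else 0 := by
    rw [h1, Finset.sum_comm]
    refine Finset.sum_congr rfl fun v _ => Finset.sum_congr rfl fun w _ => ?_
    simp [G.adj_comm]
  have h3 : ∑ v, ∑ w, (if G.Adj v w then (f v - f w) ^ 2 else 0)
      ≤ ∑ v, ∑ w, (2 * (if G.Adj v w then f v ^ 2 else 0)
        + 2 * (if G.Adj v w then f w ^ 2 else 0)) := by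
    refine Finset.sum_le_sum fun v _ => Finset.sum_le_sum fun w _ => ?_
    split_ifs
    · nlinarith [sq_nonneg (f v + f w)]
    · simp
  simp only [Finset.sum_add_distrib, ← Finset.mul_sum, ← h1, ← h2] at h3
  unfold quadForm
  linarith

lemma lapEig_bounds {V : Type*} [Fintype V] (G : SimpleGraph V)
    (hd : ∀ v, degN G v = 1 ∨ degN G v = 3) (hV : 2 ≤ Fintype.card V)
    (C : ℝ) (hC : 0 < C) (hP : Poinc G C) : 1 / C ≤ lapEig G 1 ∧ lapEig G 1 ≤ 2 := by
  obtain ⟨φ, hφ⟩ := hP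
  have low : ∀ r ∈ {r : ℝ | ∃ W : Submodule ℝ (V → ℝ), Module.finrank ℝ W = 1 + 1 ∧
    ∀ f ∈ W, quadForm G f ≤ r * lapNormSq G f}, 1 / C ≤ r := by
    rintro r ⟨W, hW, h⟩
    have hk : LinearMap.ker (φ.domRestrict W) ≠ ⊥ :=
      LinearMap.ker_ne_bot_of_finrank_lt (by rw [hW]; simp)
    obtain ⟨f, hf, hf0⟩ := Submodule.exists_mem_ne_zero_of_ne_bot hk
    have hfz : φ f = 0 := hf
    have h1 := hφ f hfz
    have h2 := h f f.2
    have h3 := lap_pos G hd (f : V → ℝ) (by simpa using hf0)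
    rw [div_le_iff₀ hC]
    have : lapNormSq G f * 1 ≤ lapNormSq G f * (r * C) := by nlinarith
    exact le_of_mul_le_mul_left this h3
  have mem : (2 : ℝ) ∈ {r : ℝ | ∃ W : Submodule ℝ (V → ℝ), Module.finrank ℝ W = 1 + 1 ∧
    ∀ f ∈ W, quadForm G f ≤ r * lapNormSq G f} := by
    have : ∃ s : V → Fin 2, Function.Surjective s := by
      let e := Fintype.equivFin V
      refine ⟨fun v => if (e v).val = 0 then 0 else 1, fun i => ?_⟩
      fin_cases i
      · exact ⟨e.symm ⟨0, by omega⟩, by simp⟩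
      · exact ⟨e.symm ⟨1, by omega⟩, by simp⟩
    obtain ⟨s, hs⟩ := this
    refine ⟨LinearMap.range (LinearMap.funLeft ℝ ℝ s), ?_, fun f _ => quad_le G f⟩
    rw [LinearMap.finrank_range_of_inj (LinearMap.funLeft_injective_of_surjective ℝ ℝ s hs)]
    simp
  exact ⟨le_csInf ⟨2, mem⟩ low, csInf_le ⟨1 / C, low⟩ mem⟩

/-- The combinatorial requirements. -/
def Comb {V : Type*} (G : SimpleGraph V) (a b : ℕ) : Prop :=
  G.Connected ∧ (∀ v, degN G v = 1 ∨ degN G v = 3) ∧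
    {v | degN G v = 3}.ncard = a ∧ {v | degN G v = 1}.ncard = b

lemma degN_comap {V V' : Type*} (G : SimpleGraph V) (e : V' ≃ V) (v : V') :
    degN (G.comap e) v = degN G (e v) := by
  unfold degN
  have : {w | G.Adj (e v) w} = e '' {w | (G.comap e).Adj v w} := by
    ext w
    simp only [Set.mem_image, Set.mem_ofPred_eq, SimpleGraph.comap_adj]
    constructor
    · intro h; exact ⟨e.symm w, by simpa using h, by simp⟩
    · rintro ⟨x, h, rfl⟩; exact h
  rw [this, Set.ncard_image_of_injective _ e.injective]

lemma ncard_comap {V V' : Type*} (e : V' ≃ V) (p : V → Prop) :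
    {v | p (e v)}.ncard = {v | p v}.ncard := by
  have : {v | p v} = e '' {v | p (e v)} := by
    ext w
    simp only [Set.mem_image, Set.mem_ofPred_eq]
    constructor
    · intro h; exact ⟨e.symm w, by simpa using h, by simp⟩
    · rintro ⟨x, h, rfl⟩; exact h
  rw [this, Set.ncard_image_of_injective _ e.injective]

lemma Comb.comap {V V' : Type*} {G : SimpleGraph V} {a b : ℕ} (h : Comb G a b) (e : V' ≃ V) :
    Comb (G.comap e) a b := by
  obtain ⟨h1, h2, h3, h4⟩ := h
  refine ⟨(SimpleGraph.Iso.comap e G).connected_iff.mpr h1, fun v => ?_, ?_, ?_⟩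
  · rw [degN_comap]; exact h2 _
  · simp only [degN_comap]; rw [← h3]; exact ncard_comap e (fun v => degN G v = 3)
  · simp only [degN_comap]; rw [← h4]; exact ncard_comap e (fun v => degN G v = 1)

lemma Poinc.comap {V V' : Type*} [Fintype V] [Fintype V'] {G : SimpleGraph V} {C : ℝ}
    (h : Poinc G C) (e : V' ≃ V) : Poinc (G.comap e) C := by
  obtain ⟨φ, hφ⟩ := h
  refine ⟨φ ∘ₗ LinearMap.funLeft ℝ ℝ e.symm, fun f hf => ?_⟩
  have h1 := hφ _ hf
  have e1 : lapNormSq G (LinearMap.funLeft ℝ ℝ e.symm f) = lapNormSq (G.comap e) f := by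
    unfold lapNormSq
    rw [← Equiv.sum_comp e]
    simp [degN_comap]
  have e2 : quadForm G (LinearMap.funLeft ℝ ℝ e.symm f) = quadForm (G.comap e) f := by
    unfold quadForm
    rw [← Equiv.sum_comp e]
    congr 1
    refine Finset.sum_congr rfl fun v _ => ?_
    rw [← Equiv.sum_comp e]
    refine Finset.sum_congr rfl fun w _ => ?_
    have : (G.comap e).Adj v w ↔ G.Adj (e v) (e w) := Iff.rfl
    by_cases h : G.Adj (e v) (e w)
    · rw [if_pos h, if_pos (this.mpr h)]; simp
    · rw [if_neg h, if_neg (fun h' => h (this.mp h'))]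
  rwa [e1, e2] at h1

section cg
variable {X : Type*}

/-- Relation generating the graph: cyclic successor, involution partner, leaf. -/
def cgRel (σ : Equiv.Perm X) (τ : X → X) : X ⊕ {x // τ x = x} → X ⊕ {x // τ x = x} → Prop
  | .inl x, .inl y => y = σ x ∨ y = τ x
  | .inl x, .inr p => p.1 = x
  | .inr _, _ => False

/-- The graph with cyclic structure `σ`, chords `τ`, and a leaf at each fixed point of `τ`. -/
def cg (σ : Equiv.Perm X) (τ : X → X) : SimpleGraph (X ⊕ {x // τ x = x}) :=
  SimpleGraph.fromRel (cgRel σ τ)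

/-- Admissibility of the pair. -/
structure Adm (σ : Equiv.Perm X) (τ : X → X) : Prop where
  h1 : ∀ x, σ x ≠ x
  h2 : ∀ x, σ (σ x) ≠ x
  inv : ∀ x, τ (τ x) = x
  h3 : ∀ x, τ x ≠ σ x

open Classical in
/-- third neighbour -/
noncomputable def thd (τ : X → X) (x : X) : X ⊕ {x // τ x = x} :=
  if h : τ x = x then .inr ⟨x, h⟩ else .inl (τ x)

variable {σ : Equiv.Perm X} {τ : X → X}

lemma Adm.h4 (H : Adm σ τ) (x : X) : τ x ≠ σ.symm x := by
  intro h
  apply H.h3 (σ.symm x)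
  rw [← h, H.inv, h]; simp

lemma cg_adj_inl (H : Adm σ τ) (x : X) (w) :
    (cg σ τ).Adj (.inl x) w ↔ w = .inl (σ x) ∨ w = .inl (σ.symm x) ∨ w = thd τ x := by
  rcases w with y | p
  · simp only [cg, SimpleGraph.fromRel_adj, cgRel, thd, ne_eq, Sum.inl.injEq]
    have e1 : x = σ y ↔ y = σ.symm x := by rw [Equiv.eq_symm_apply]; exact eq_comm
    have e2 : x = τ y ↔ y = τ x := by
      constructor <;> (intro h; rw [h, H.inv])
    rw [e1, e2]
    have n1 : y = σ x → x ≠ y := by rintro rfl; exact (H.h1 x).symm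
    have n2 : y = σ.symm x → x ≠ y := by
      rintro rfl h; exact H.h1 (σ.symm x) (by simpa using h)
    split_ifs with h
    · simp only [reduceCtorEq, or_false]
      constructor
      · rintro ⟨h0, (h1 | h1) | (h1 | h1)⟩
        · exact Or.inl h1
        · exact absurd (h1.trans h).symm h0
        · exact Or.inr h1
        · exact absurd (h1.trans h).symm h0
      · rintro (h1 | h1)
        · exact ⟨n1 h1, Or.inl (Or.inl h1)⟩
        · exact ⟨n2 h1, Or.inr (Or.inl h1)⟩
    · simp only [Sum.inl.injEq]
      have n3 : y = τ x → x ≠ y := by rintro rfl; exact fun h' => h h'.symm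
      constructor
      · tauto
      · rintro (h1 | h1 | h1)
        · exact ⟨n1 h1, Or.inl (Or.inl h1)⟩
        · exact ⟨n2 h1, Or.inr (Or.inl h1)⟩
        · exact ⟨n3 h1, Or.inl (Or.inr h1)⟩
  · obtain ⟨p, hp⟩ := p
    simp only [cg, SimpleGraph.fromRel_adj, cgRel, thd, ne_eq, reduceCtorEq, not_false_eq_true,
      true_and, or_false, false_or]
    split_ifs with h
    · simp
    · simp only [reduceCtorEq, iff_false]
      rintro rfl; exact h hp

lemma cg_adj_inr (p : {x // τ x = x}) (w) :
    (cg σ τ).Adj (.inr p) w ↔ w = .inl p.1 := by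
  rcases w with y | q
  · simp [cg, cgRel, eq_comm]
  · simp [cg, cgRel]

lemma cg_distinct (H : Adm σ τ) (x : X) :
    (Sum.inl (σ x) : X ⊕ {x // τ x = x}) ≠ .inl (σ.symm x) ∧ .inl (σ x) ≠ thd τ x ∧
      .inl (σ.symm x) ≠ thd τ x := by
  refine ⟨?_, ?_, ?_⟩
  · intro h
    apply H.h2 x
    rw [Sum.inl.injEq] at h
    rw [h]; simp
  · unfold thd; split_ifs
    · simp
    · simpa using (H.h3 x).symm
  · unfold thd; split_ifs
    · simp
    · simpa using (H.h4 x).symm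

lemma degN_inl (H : Adm σ τ) (x : X) : degN (cg σ τ) (.inl x) = 3 := by
  obtain ⟨a, b, c⟩ := cg_distinct H x
  unfold degN
  rw [Set.ncard_eq_three]
  exact ⟨_, _, _, a, b, c, by ext w; simp [cg_adj_inl H]⟩

lemma degN_inr (p : {x // τ x = x}) : degN (cg σ τ) (.inr p) = 1 := by
  unfold degN
  rw [Set.ncard_eq_one]
  exact ⟨.inl p.1, by ext w; simp [cg_adj_inr]⟩

variable [Fintype X] [Fintype {x // τ x = x}]

lemma cg_comb (H : Adm σ τ) (hc : (cg σ τ).Connected) :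
    Comb (cg σ τ) (Fintype.card X) (Fintype.card {x // τ x = x}) := by
  refine ⟨hc, ?_, ?_, ?_⟩
  · rintro (x | p)
    · exact Or.inr (degN_inl H x)
    · exact Or.inl (degN_inr p)
  · have : {v | degN (cg σ τ) v = 3} = Sum.inl '' (Set.univ : Set X) := by
      ext v
      rcases v with x | p
      · simp [degN_inl H]
      · simp [degN_inr]
    rw [this, Set.ncard_image_of_injective _ Sum.inl_injective, Set.ncard_univ,
      Nat.card_eq_fintype_card]
  · have : {v | degN (cg σ τ) v = 1} = Sum.inr '' (Set.univ : Set {x // τ x = x}) := by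
      ext v
      rcases v with x | p
      · simp [degN_inl H]
      · simp [degN_inr]
    rw [this, Set.ncard_image_of_injective _ Sum.inr_injective, Set.ncard_univ,
      Nat.card_eq_fintype_card]

lemma cg_lap (H : Adm σ τ) (f) : lapNormSq (cg σ τ) f
    = 3 * ∑ x, f (.inl x) ^ 2 + ∑ p, f (.inr p) ^ 2 := by
  unfold lapNormSq
  rw [Fintype.sum_sum_type]
  simp [degN_inl H, degN_inr, Finset.mul_sum]

lemma cg_quad (H : Adm σ τ) (f) : quadForm (cg σ τ) f
    = ∑ x, (f (.inl (σ x)) - f (.inl x)) ^ 2 + 1 / 2 * ∑ x, (f (.inl x) - f (.inl (τ x))) ^ 2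
      + ∑ p, (f (.inr p) - f (.inl p.1)) ^ 2 := by
  classical
  unfold quadForm
  rw [Fintype.sum_sum_type]
  have a1 : ∀ x, (∑ w, if (cg σ τ).Adj (.inl x) w then (f (.inl x) - f w) ^ 2 else 0)
      = (f (.inl x) - f (.inl (σ x))) ^ 2 + (f (.inl x) - f (.inl (σ.symm x))) ^ 2
        + (f (.inl x) - f (thd τ x)) ^ 2 := by
    intro x
    obtain ⟨a, b, c⟩ := cg_distinct H x
    rw [← Finset.sum_filter]
    have : Finset.univ.filter (fun w => (cg σ τ).Adj (.inl x) w)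
        = {.inl (σ x), .inl (σ.symm x), thd τ x} := by
      ext w; simp [cg_adj_inl H]
    rw [this, Finset.sum_insert (by simp [a, b]), Finset.sum_insert (by simp [c]),
      Finset.sum_singleton]
    ring
  have a2 : ∀ p, (∑ w, if (cg σ τ).Adj (.inr p) w then (f (.inr p) - f w) ^ 2 else 0)
      = (f (.inr p) - f (.inl p.1)) ^ 2 := by
    intro p
    simp only [cg_adj_inr]
    simp
  have a3 : ∑ x, (f (.inl x) - f (thd τ x)) ^ 2 = ∑ x, (f (.inl x) - f (.inl (τ x))) ^ 2
      + ∑ p : {x // τ x = x}, (f (.inr p) - f (.inl p.1)) ^ 2 := by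
    have : ∑ p : {x // τ x = x}, (f (.inr p) - f (.inl p.1)) ^ 2
        = ∑ x, if h : τ x = x then (f (.inr ⟨x, h⟩) - f (.inl x)) ^ 2 else 0 := by
      rw [Finset.sum_dite]
      simp only [Finset.sum_const_zero, add_zero]
      refine Finset.sum_bij (fun p _ => ⟨p.1, by simp [p.2]⟩) ?_ ?_ ?_ ?_
      · simp
      · intro a _ b _ h; simpa [Subtype.ext_iff] using h
      · rintro ⟨x, hx⟩ _
        exact ⟨⟨x, by simpa using hx⟩, by simp, rfl⟩
      · simp
    rw [this, ← Finset.sum_add_distrib]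
    refine Finset.sum_congr rfl fun x _ => ?_
    unfold thd
    split_ifs with h
    · rw [h]; ring
    · simp
  have a4 : ∑ x, (f (.inl x) - f (.inl (σ.symm x))) ^ 2 = ∑ x, (f (.inl (σ x)) - f (.inl x)) ^ 2 := by
    rw [← Equiv.sum_comp σ]; simp
  have a5 : ∑ x, (f (.inl x) - f (.inl (σ x))) ^ 2 = ∑ x, (f (.inl (σ x)) - f (.inl x)) ^ 2 :=
    Finset.sum_congr rfl fun x _ => by ring
  simp only [a1, a2, Finset.sum_add_distrib, a3, a4, a5]
  ring

end cg


lemma conn_of_poinc {V : Type*} [Fintype V] [Nonempty V] (G : SimpleGraph V)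
    (hd : ∀ v, degN G v = 1 ∨ degN G v = 3) (C : ℝ) (φ : (V → ℝ) →ₗ[ℝ] ℝ)
    (hφ : ∀ f, φ f = 0 → lapNormSq G f ≤ C * quadForm G f) (h1 : φ (fun _ => 1) ≠ 0) :
    G.Connected := by
  classical
  refine ⟨fun u v => ?_⟩
  by_contra hn
  let ind : V → ℝ := fun w => if G.Reachable u w then 1 else 0
  let c : ℝ := φ ind / φ (fun _ => 1)
  let f : V → ℝ := ind - c • (fun _ => (1 : ℝ))
  have hf0 : φ f = 0 := by
    simp only [f, map_sub, map_smul, smul_eq_mul, c]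
    field_simp
    ring
  have hQ : quadForm G f = 0 := by
    unfold quadForm
    rw [Finset.sum_eq_zero, mul_zero]
    intro x _
    refine Finset.sum_eq_zero fun y _ => ?_
    split_ifs with h
    · have : G.Reachable u x ↔ G.Reachable u y :=
        ⟨fun h' => h'.trans h.reachable, fun h' => h'.trans h.symm.reachable⟩
      simp [f, ind, this]
    · rfl
  have hl := hφ f hf0
  rw [hQ, mul_zero] at hl
  have hz : f = 0 := by
    by_contra hne
    exact absurd (lap_pos G hd f hne) (not_lt.mpr hl)
  have hu := congrFun hz u
  have hv := congrFun hz v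
  simp [f, ind] at hu
  simp [f, ind, hn] at hv
  linarith

lemma five_sq (a b c d e : ℝ) : (a + b + c + d + e) ^ 2 ≤
    5 * (a ^ 2 + b ^ 2 + c ^ 2 + d ^ 2 + e ^ 2) := by
  nlinarith [sq_nonneg (a - b), sq_nonneg (a - c), sq_nonneg (a - d), sq_nonneg (a - e),
    sq_nonneg (b - c), sq_nonneg (b - d), sq_nonneg (b - e), sq_nonneg (c - d),
    sq_nonneg (c - e), sq_nonneg (d - e)]

lemma path_sq (a : ℕ → ℝ) (N i j : ℕ) (hij : i ≤ j) (hj : j ≤ N) :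
    (a j - a i) ^ 2 ≤ N * ∑ k ∈ Finset.range N, (a (k + 1) - a k) ^ 2 := by
  rw [← Finset.sum_Ico_sub a hij]
  refine sq_sum_le_card_mul_sum_sq.trans ?_
  have h1 : ∑ k ∈ Finset.Ico i j, (a (k + 1) - a k) ^ 2
      ≤ ∑ k ∈ Finset.range N, (a (k + 1) - a k) ^ 2 := by
    refine Finset.sum_le_sum_of_subset_of_nonneg ?_ (fun _ _ _ => sq_nonneg _)
    intro k hk
    simp only [Finset.mem_Ico, Finset.mem_range] at *
    omega
  have h2 : ((Finset.Ico i j).card : ℝ) ≤ N := by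
    rw [Nat.card_Ico]; exact_mod_cast (by omega)
  exact mul_le_mul h2 h1 (Finset.sum_nonneg fun _ _ => sq_nonneg _) (Nat.cast_nonneg _)

section big
variable {H : Type*}

/-- Block rotation. -/
def bsig (H : Type*) (K : ℕ) : Equiv.Perm (H × Fin (K + 12)) :=
  Equiv.prodCongr (Equiv.refl H) (finRotate (K + 12))

open Classical in
/-- Block involution. -/
noncomputable def btau (K : ℕ) (g : ℕ → Equiv.Perm H) (C : Finset (H × ℕ)) (x : H × Fin (K + 12)) :
    H × Fin (K + 12) :=
  if h : x.2.val < 4 then ((g x.2.val).symm x.1, ⟨x.2.val + 4, by omega⟩)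
  else if h : x.2.val < 8 then (g (x.2.val - 4) x.1, ⟨x.2.val - 4, by omega⟩)
  else if h : x.2.val < 10 then
    if (x.1, x.2.val) ∈ C then (x.1, ⟨x.2.val + 2, by omega⟩) else x
  else if h : x.2.val < 12 then
    if (x.1, x.2.val - 2) ∈ C then (x.1, ⟨x.2.val - 2, by omega⟩) else x
  else x

variable {K : ℕ} {g : ℕ → Equiv.Perm H} {C : Finset (H × ℕ)}

lemma btau_a (v : H) (j : ℕ) (hj : j < K + 12) (h : j < 4) :
    btau K g C (v, ⟨j, hj⟩) = ((g j).symm v, ⟨j + 4, by omega⟩) := by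
  simp [btau, h]

lemma btau_b (v : H) (j : ℕ) (hj : j < K + 12) (h : ¬ j < 4) (h' : j < 8) :
    btau K g C (v, ⟨j, hj⟩) = (g (j - 4) v, ⟨j - 4, by omega⟩) := by
  simp [btau, h, h']

lemma btau_c (v : H) (j : ℕ) (hj : j < K + 12) (h : ¬ j < 8) (h' : j < 10) (hC : (v, j) ∈ C) :
    btau K g C (v, ⟨j, hj⟩) = (v, ⟨j + 2, by omega⟩) := by
  have : ¬ j < 4 := by omega
  simp [btau, h, h', this, hC]

lemma btau_c' (v : H) (j : ℕ) (hj : j < K + 12) (h : ¬ j < 8) (h' : j < 10) (hC : (v, j) ∉ C) :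
    btau K g C (v, ⟨j, hj⟩) = (v, ⟨j, hj⟩) := by
  have : ¬ j < 4 := by omega
  simp [btau, h, h', this, hC]

lemma btau_d (v : H) (j : ℕ) (hj : j < K + 12) (h : ¬ j < 10) (h' : j < 12)
    (hC : (v, j - 2) ∈ C) :
    btau K g C (v, ⟨j, hj⟩) = (v, ⟨j - 2, by omega⟩) := by
  have h4 : ¬ j < 4 := by omega
  have h8 : ¬ j < 8 := by omega
  simp [btau, h, h', h4, h8, hC]

lemma btau_d' (v : H) (j : ℕ) (hj : j < K + 12) (h : ¬ j < 10) (h' : j < 12)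
    (hC : (v, j - 2) ∉ C) :
    btau K g C (v, ⟨j, hj⟩) = (v, ⟨j, hj⟩) := by
  have h4 : ¬ j < 4 := by omega
  have h8 : ¬ j < 8 := by omega
  simp [btau, h, h', h4, h8, hC]

lemma btau_e (v : H) (j : ℕ) (hj : j < K + 12) (h : ¬ j < 12) :
    btau K g C (v, ⟨j, hj⟩) = (v, ⟨j, hj⟩) := by
  have h4 : ¬ j < 4 := by omega
  have h8 : ¬ j < 8 := by omega
  have h10 : ¬ j < 10 := by omega
  simp [btau, h, h4, h8, h10]

lemma rot_val (j : Fin (K + 12)) :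
    ((finRotate (K + 12) j).val = j.val + 1 ∧ j.val < K + 11) ∨
      ((finRotate (K + 12) j).val = 0 ∧ j.val = K + 11) := by
  by_cases h : j = Fin.last (K + 11)
  · right
    subst h
    simp
  · left
    refine ⟨coe_finRotate_of_ne_last h, ?_⟩
    have := j.2
    have : j.val ≠ K + 11 := fun h' => h (Fin.ext h')
    omega

lemma badm : Adm (bsig H K) (btau K g C) where
  h1 := by
    rintro ⟨v, j⟩ h
    have h' : finRotate (K + 12) j = j := congrArg Prod.snd h
    rcases rot_val j with r | r <;> rw [h'] at r <;> omega
  h2 := by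
    rintro ⟨v, j⟩ h
    have h' : finRotate (K + 12) (finRotate (K + 12) j) = j := congrArg Prod.snd h
    have r2 := rot_val (finRotate (K + 12) j)
    rw [h'] at r2
    rcases rot_val j with r | r <;> omega
  inv := by
    rintro ⟨v, ⟨j, hj⟩⟩
    by_cases c4 : j < 4
    · rw [btau_a v j hj c4, btau_b _ _ _ (by omega) (by omega)]
      simp
    by_cases c8 : j < 8
    · rw [btau_b v j hj c4 c8, btau_a _ _ _ (by omega)]
      simp
      omega
    by_cases c10 : j < 10
    · by_cases hC : (v, j) ∈ C
      · rw [btau_c v j hj c8 c10 hC, btau_d _ _ _ (by omega) (by omega) (by simpa using hC)]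
        simp
      · rw [btau_c' v j hj c8 c10 hC, btau_c' v j hj c8 c10 hC]
    by_cases c12 : j < 12
    · by_cases hC : (v, j - 2) ∈ C
      · rw [btau_d v j hj c10 c12 hC, btau_c _ _ _ (by omega) (by omega) hC]
        simp
        omega
      · rw [btau_d' v j hj c10 c12 hC, btau_d' v j hj c10 c12 hC]
    · rw [btau_e v j hj c12, btau_e v j hj c12]
  h3 := by
    rintro ⟨v, ⟨j, hj⟩⟩ h
    have h' : (btau K g C (v, ⟨j, hj⟩)).2.val = (finRotate (K + 12) ⟨j, hj⟩).val :=
      congrArg (fun z => z.2.val) h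
    have r := rot_val (K := K) ⟨j, hj⟩
    rw [← h'] at r
    simp only at r
    clear h h'
    by_cases c4 : j < 4
    · rw [btau_a v j hj c4] at r; simp only at r; omega
    by_cases c8 : j < 8
    · rw [btau_b v j hj c4 c8] at r; simp only at r; omega
    by_cases c10 : j < 10
    · by_cases hC : (v, j) ∈ C
      · rw [btau_c v j hj c8 c10 hC] at r; simp only at r; omega
      · rw [btau_c' v j hj c8 c10 hC] at r; simp only at r; omega
    by_cases c12 : j < 12
    · by_cases hC : (v, j - 2) ∈ C
      · rw [btau_d v j hj c10 c12 hC] at r; simp only at r; omega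
      · rw [btau_d' v j hj c10 c12 hC] at r; simp only at r; omega
    · rw [btau_e v j hj c12] at r; simp only at r; omega

variable [Fintype H] [Fintype {x // btau K g C x = x}]

lemma bcard (hC : ∀ x ∈ C, x.2 = 8 ∨ x.2 = 9) :
    Fintype.card {x // btau K g C x = x} + (8 * Fintype.card H + 2 * C.card)
      = Fintype.card H * (K + 12) := by
  classical
  let A : Finset (H × Fin (K + 12)) := Finset.univ ×ˢ Finset.univ.filter (fun j => j.val < 8)
  let B : Finset (H × Fin (K + 12)) := Finset.univ.filter (fun x => (x.1, x.2.val) ∈ C)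
  let B' : Finset (H × Fin (K + 12)) :=
    Finset.univ.filter (fun x => 10 ≤ x.2.val ∧ (x.1, x.2.val - 2) ∈ C)
  have hA : A.card = 8 * Fintype.card H := by
    have : (Finset.univ.filter (fun j : Fin (K + 12) => j.val < 8)).card = 8 := by
      have : Finset.univ.filter (fun j : Fin (K + 12) => j.val < 8)
          = Finset.univ.map (Fin.castLEEmb (by omega : 8 ≤ K + 12)) := by
        ext j
        simp only [Finset.mem_filter, Finset.mem_univ, true_and, Finset.mem_map]
        constructor
        · intro h; exact ⟨⟨j, h⟩, rfl⟩
        · rintro ⟨i, rfl⟩; exact i.2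
      rw [this]; simp
    simp only [A, Finset.card_product, this, Finset.card_univ]
    ring
  have hB : B.card = C.card := by
    refine Finset.card_bij (fun x _ => (x.1, x.2.val)) ?_ ?_ ?_
    · intro x hx; simpa [B] using hx
    · rintro ⟨v, j⟩ _ ⟨w, k⟩ _ h
      simp only [Prod.mk.injEq] at h
      ext
      · exact h.1
      · exact h.2
    · rintro ⟨v, j⟩ hx
      have := hC _ hx
      simp only at this
      exact ⟨(v, ⟨j, by omega⟩), by simpa [B] using hx, rfl⟩
  have hB' : B'.card = C.card := by
    refine Finset.card_bij (fun x _ => (x.1, x.2.val - 2)) ?_ ?_ ?_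
    · intro x hx; simp [B'] at hx; exact hx.2
    · rintro ⟨v, j⟩ h1 ⟨w, k⟩ h2 h
      simp [B'] at h1 h2
      simp only [Prod.mk.injEq] at h
      ext
      · exact h.1
      · simp only; omega
    · rintro ⟨v, j⟩ hx
      have := hC _ hx
      simp only at this
      exact ⟨(v, ⟨j + 2, by omega⟩), by simp [B', hx]; omega, by simp⟩
  have hAB : Disjoint A B := by
    rw [Finset.disjoint_left]
    rintro ⟨v, j⟩ h1 h2
    simp [A, B] at h1 h2
    have := hC _ h2
    simp only at this
    omega
  have hABB : Disjoint (A ∪ B) B' := by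
    rw [Finset.disjoint_left]
    rintro ⟨v, j⟩ h1 h2
    simp [A, B, B'] at h1 h2
    rcases h1 with h1 | h1
    · omega
    · have := hC _ h1
      simp only at this
      omega
  have hfix : Finset.univ.filter (fun x => ¬ btau K g C x = x) = (A ∪ B) ∪ B' := by
    ext ⟨v, ⟨j, hj⟩⟩
    simp only [Finset.mem_filter, Finset.mem_univ, true_and, Finset.mem_union, A, B, B',
      Finset.mem_product]
    have c1 : (v, j) ∈ C → j = 8 ∨ j = 9 := fun h => hC _ h
    have c2 : (v, j - 2) ∈ C → j - 2 = 8 ∨ j - 2 = 9 := fun h => hC _ h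
    by_cases c4 : j < 4
    · rw [btau_a v j hj c4]
      have : j < 8 := by omega
      simp [this]
    by_cases c8 : j < 8
    · rw [btau_b v j hj c4 c8]
      simp [c8]
      intro _; omega
    by_cases c10 : j < 10
    · have : ¬ 10 ≤ j := by omega
      by_cases hC : (v, j) ∈ C
      · rw [btau_c v j hj c8 c10 hC]
        simp [hC]
      · rw [btau_c' v j hj c8 c10 hC]
        simp [hC, c8, this]
    have hn : (v, j) ∉ C := fun h => by have := c1 h; omega
    have h10 : 10 ≤ j := by omega
    by_cases c12 : j < 12
    · by_cases hC : (v, j - 2) ∈ C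
      · rw [btau_d v j hj c10 c12 hC]
        simp [hC, h10]
        omega
      · rw [btau_d' v j hj c10 c12 hC]
        simp [hC, c8, hn]
    · have : (v, j - 2) ∉ C := fun h => by have := c2 h; omega
      rw [btau_e v j hj c12]
      simp [c8, hn, this]
  have htot := Finset.card_filter_add_card_filter_not (s := (Finset.univ : Finset (H × Fin (K + 12))))
    (fun x => btau K g C x = x)
  rw [hfix, Finset.card_union_of_disjoint hABB, Finset.card_union_of_disjoint hAB, hA, hB, hB',
    Finset.card_univ, Fintype.card_prod, Fintype.card_fin] at htot
  rw [← htot, Fintype.card_of_subtype (Finset.univ.filter (fun x => btau K g C x = x)) (by simp)]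
  ring


lemma bpoinc (hg : ∀ F : H → ℝ, ∑ v, F v = 0 → 7 / 20 * ∑ v, F v ^ 2 ≤
      ∑ v, (F v - F (g 0 v)) ^ 2 + ∑ v, (F v - F (g 1 v)) ^ 2
      + ∑ v, (F v - F (g 2 v)) ^ 2 + ∑ v, (F v - F (g 3 v)) ^ 2)
    (f : (H × Fin (K + 12)) ⊕ {x // btau K g C x = x} → ℝ)
    (hf : ∑ v, f (.inl (v, ⟨4, by omega⟩)) = 0) :
    lapNormSq (cg (bsig H K) (btau K g C)) f ≤
      (4000 / 7 * (K + 12) + 10 * (K + 12) ^ 2 + 2) *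
        quadForm (cg (bsig H K) (btau K g C)) f := by
  classical
  rw [cg_lap badm, cg_quad badm]
  -- positions as naturals
  let a : H → ℕ → ℝ := fun v k => if hk : k < K + 12 then f (.inl (v, ⟨k, hk⟩)) else 0
  have ha : ∀ v k (hk : k < K + 12), f (.inl (v, ⟨k, hk⟩)) = a v k := by
    intro v k hk; simp [a, hk]
  have hS : ∑ x, f (.inl x) ^ 2 = ∑ v, ∑ k ∈ Finset.range (K + 12), a v k ^ 2 := by
    rw [Fintype.sum_prod_type]
    refine Finset.sum_congr rfl fun v _ => ?_
    rw [← Fin.sum_univ_eq_sum_range (fun k => a v k ^ 2)]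
    refine Finset.sum_congr rfl fun j _ => ?_
    rw [← ha v j.val j.2]
  let D : H → ℝ := fun v => ∑ k ∈ Finset.range (K + 11), (a v (k + 1) - a v k) ^ 2
  have hE : ∑ v, D v ≤ ∑ x, (f (.inl (bsig H K x)) - f (.inl x)) ^ 2 := by
    rw [Fintype.sum_prod_type]
    refine Finset.sum_le_sum fun v _ => ?_
    rw [Fin.sum_univ_castSucc]
    simp only [D]
    rw [← Fin.sum_univ_eq_sum_range (fun k => (a v (k + 1) - a v k) ^ 2)]
    have : ∀ i : Fin (K + 11), (f (.inl (bsig H K (v, i.castSucc))) - f (.inl (v, i.castSucc))) ^ 2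
        = (a v (i.val + 1) - a v i.val) ^ 2 := by
      intro i
      have e : bsig H K (v, i.castSucc) = (v, ⟨i.val + 1, by omega⟩) := by
        have := rot_val (K := K) i.castSucc
        have h2 := i.2
        simp only [bsig, Equiv.prodCongr_apply, Prod.map, Equiv.refl_apply, Prod.mk.injEq, true_and]
        ext
        simp only [Fin.val_castSucc] at *
        omega
      rw [e, ha, ← ha v i.val (by omega)]
      rfl
    simp only [this]
    exact le_add_of_nonneg_right (sq_nonneg _)
  have hT : ∀ v, ∑ j : Fin (K + 12), (f (.inl (v, j)) - f (.inl (btau K g C (v, j)))) ^ 2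
      ≥ ∑ i ∈ Finset.range 4, (a v i - a ((g i).symm v) (i + 4)) ^ 2
        + ∑ i ∈ Finset.range 4, (a v (i + 4) - a (g i v) i) ^ 2 := by
    intro v
    let b : ℕ → ℝ := fun k => if hk : k < K + 12 then
      (f (.inl (v, ⟨k, hk⟩)) - f (.inl (btau K g C (v, ⟨k, hk⟩)))) ^ 2 else 0
    have hb : ∀ k (hk : k < K + 12),
      (f (.inl (v, ⟨k, hk⟩)) - f (.inl (btau K g C (v, ⟨k, hk⟩)))) ^ 2 = b k := by
      intro k hk; simp [b, hk]
    have e1 : ∑ j : Fin (K + 12), (f (.inl (v, j)) - f (.inl (btau K g C (v, j)))) ^ 2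
        = ∑ k ∈ Finset.range (K + 12), b k := by
      rw [← Fin.sum_univ_eq_sum_range b]
      exact Finset.sum_congr rfl fun j _ => hb j.val j.2
    rw [e1]
    have e2 : ∑ k ∈ Finset.range 8, b k ≤ ∑ k ∈ Finset.range (K + 12), b k := by
      refine Finset.sum_le_sum_of_subset_of_nonneg ?_ ?_
      · intro k; simp only [Finset.mem_range]; omega
      · intro k _ _; simp only [b]; split_ifs
        · positivity
        · exact le_rfl
    refine le_trans (le_of_eq ?_) e2
    rw [Finset.sum_range_add b 4 4]
    refine congrArg₂ (· + ·) ?_ ?_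
    · refine Finset.sum_congr rfl fun i hi => ?_
      rw [Finset.mem_range] at hi
      rw [← hb i (by omega), btau_a v i _ hi, ha, ha]
    · refine Finset.sum_congr rfl fun i hi => ?_
      rw [Finset.mem_range] at hi
      rw [← hb (4 + i) (by omega), btau_b v (4 + i) _ (by omega) (by omega), ha, ha]
      simp [add_comm]
  -- external energy
  let X : ℕ → ℝ := fun i => ∑ v, (a v (i + 4) - a (g i v) i) ^ 2
  have hX : X 0 + X 1 + X 2 + X 3
      ≤ 1 / 2 * ∑ x, (f (.inl x) - f (.inl (btau K g C x))) ^ 2 := by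
    have h1 := Finset.sum_le_sum fun v (_ : v ∈ (Finset.univ : Finset H)) => hT v
    rw [Fintype.sum_prod_type]
    have h2 : ∑ v, ∑ i ∈ Finset.range 4, (a v i - a ((g i).symm v) (i + 4)) ^ 2
        = ∑ i ∈ Finset.range 4, X i := by
      rw [Finset.sum_comm]
      refine Finset.sum_congr rfl fun i _ => ?_
      simp only [X]
      rw [← Equiv.sum_comp (g i)]
      refine Finset.sum_congr rfl fun v _ => ?_
      rw [Equiv.symm_apply_apply]
      ring
    have h3 : ∑ v, ∑ i ∈ Finset.range 4, (a v (i + 4) - a (g i v) i) ^ 2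
        = ∑ i ∈ Finset.range 4, X i := Finset.sum_comm
    rw [Finset.sum_add_distrib, h2, h3] at h1
    simp only [Finset.sum_range_succ, Finset.sum_range_zero] at h1
    linarith
  let S : ℕ → ℝ := fun k => ∑ v, (a v (k + 1) - a v k) ^ 2
  have hS0 : ∀ k, 0 ≤ S k := fun k => Finset.sum_nonneg fun _ _ => sq_nonneg _
  have hSD : S 0 + S 1 + S 2 + S 3 + S 4 + S 5 + S 6 ≤ ∑ v, D v := by
    have : ∑ k ∈ Finset.range 7, S k ≤ ∑ v, D v := by
      rw [Finset.sum_comm]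
      refine Finset.sum_le_sum fun v _ => ?_
      refine Finset.sum_le_sum_of_subset_of_nonneg ?_ (fun _ _ _ => sq_nonneg _)
      intro k; simp only [Finset.mem_range]; omega
    simpa [Finset.sum_range_succ] using this
  have hSg : ∀ i k, ∑ v, (a (g i v) (k + 1) - a (g i v) k) ^ 2 = S k := fun i k =>
    Equiv.sum_comp (g i) (fun v => (a v (k + 1) - a v k) ^ 2)
  have k0 : ∑ v, (a v 4 - a (g 0 v) 4) ^ 2 ≤ 5 * (X 0 + S 0 + S 1 + S 2 + S 3) := by
    rw [← hSg 0 0, ← hSg 0 1, ← hSg 0 2, ← hSg 0 3]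
    simp only [X, ← Finset.sum_add_distrib, Finset.mul_sum]
    refine Finset.sum_le_sum fun v _ => ?_
    have := five_sq (a v (0 + 4) - a (g 0 v) 0) (-(a (g 0 v) (0 + 1) - a (g 0 v) 0))
      (-(a (g 0 v) (1 + 1) - a (g 0 v) 1)) (-(a (g 0 v) (2 + 1) - a (g 0 v) 2))
      (-(a (g 0 v) (3 + 1) - a (g 0 v) 3))
    simp only [neg_sq] at this
    refine le_trans (le_of_eq ?_) this
    norm_num
  have k1 : ∑ v, (a v 4 - a (g 1 v) 4) ^ 2 ≤ 5 * (X 1 + S 4 + S 1 + S 2 + S 3) := by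
    rw [← hSg 1 1, ← hSg 1 2, ← hSg 1 3]
    simp only [X, S, ← Finset.sum_add_distrib, Finset.mul_sum]
    refine Finset.sum_le_sum fun v _ => ?_
    have := five_sq (a v (1 + 4) - a (g 1 v) 1) (-(a v (4 + 1) - a v 4))
      (-(a (g 1 v) (1 + 1) - a (g 1 v) 1)) (-(a (g 1 v) (2 + 1) - a (g 1 v) 2))
      (-(a (g 1 v) (3 + 1) - a (g 1 v) 3))
    simp only [neg_sq] at this
    refine le_trans (le_of_eq ?_) this
    norm_num
  have k2 : ∑ v, (a v 4 - a (g 2 v) 4) ^ 2 ≤ 5 * (X 2 + S 4 + S 5 + S 2 + S 3) := by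
    rw [← hSg 2 2, ← hSg 2 3]
    simp only [X, S, ← Finset.sum_add_distrib, Finset.mul_sum]
    refine Finset.sum_le_sum fun v _ => ?_
    have := five_sq (a v (2 + 4) - a (g 2 v) 2) (-(a v (4 + 1) - a v 4))
      (-(a v (5 + 1) - a v 5)) (-(a (g 2 v) (2 + 1) - a (g 2 v) 2))
      (-(a (g 2 v) (3 + 1) - a (g 2 v) 3))
    simp only [neg_sq] at this
    refine le_trans (le_of_eq ?_) this
    norm_num
    ring
  have k3 : ∑ v, (a v 4 - a (g 3 v) 4) ^ 2 ≤ 5 * (X 3 + S 4 + S 5 + S 6 + S 3) := by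
    rw [← hSg 3 3]
    simp only [X, S, ← Finset.sum_add_distrib, Finset.mul_sum]
    refine Finset.sum_le_sum fun v _ => ?_
    have := five_sq (a v (3 + 4) - a (g 3 v) 3) (-(a v (4 + 1) - a v 4))
      (-(a v (5 + 1) - a v 5)) (-(a v (6 + 1) - a v 6))
      (-(a (g 3 v) (3 + 1) - a (g 3 v) 3))
    simp only [neg_sq] at this
    refine le_trans (le_of_eq ?_) this
    norm_num
    ring
  have hF0 : ∑ v, a v 4 = 0 := by
    rw [← hf]; exact Finset.sum_congr rfl fun v _ => (ha v 4 (by omega)).symm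
  have gap := hg (fun v => a v 4) hF0
  -- deviations
  have dev : ∀ v, ∑ k ∈ Finset.range (K + 12), a v k ^ 2
      ≤ 2 * (K + 12) * a v 4 ^ 2 + 2 * (K + 12) ^ 2 * D v := by
    intro v
    have hD : 0 ≤ D v := Finset.sum_nonneg fun _ _ => sq_nonneg _
    have : ∀ k ∈ Finset.range (K + 12), a v k ^ 2 ≤ 2 * a v 4 ^ 2 + 2 * ((K + 12) * D v) := by
      intro k hk
      rw [Finset.mem_range] at hk
      have h1 : (a v k - a v 4) ^ 2 ≤ ((K + 11 : ℕ) : ℝ) * D v := by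
        rcases le_total 4 k with h | h
        · exact path_sq (a v) (K + 11) 4 k h (by omega)
        · have := path_sq (a v) (K + 11) k 4 h (by omega)
          rw [← neg_sq, neg_sub]; exact this
      push_cast at h1
      nlinarith [sq_nonneg (a v k - 2 * a v 4)]
    refine (Finset.sum_le_sum this).trans (le_of_eq ?_)
    rw [Finset.sum_const, Finset.card_range, nsmul_eq_mul]
    push_cast
    ring
  have hdev := Finset.sum_le_sum fun v (_ : v ∈ (Finset.univ : Finset H)) => dev v
  rw [← hS, Finset.sum_add_distrib, ← Finset.mul_sum, ← Finset.mul_sum] at hdev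
  -- leaves
  have leaf : ∑ p, f (.inr p) ^ 2 ≤ 2 * ∑ p : {x // btau K g C x = x},
      (f (.inr p) - f (.inl p.1)) ^ 2 + 2 * ∑ x, f (.inl x) ^ 2 := by
    have h1 : ∑ p : {x // btau K g C x = x}, f (.inl p.1) ^ 2 ≤ ∑ x, f (.inl x) ^ 2 := by
      rw [← Finset.sum_image (s := Finset.univ) (g := fun p : {x // btau K g C x = x} => p.1)
        (f := fun x => f (.inl x) ^ 2) (fun a _ b _ h => Subtype.ext h)]
      exact Finset.sum_le_sum_of_subset_of_nonneg (Finset.subset_univ _) (fun _ _ _ => sq_nonneg _)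
    have h2 : ∑ p, f (.inr p) ^ 2 ≤ ∑ p : {x // btau K g C x = x},
        (2 * (f (.inr p) - f (.inl p.1)) ^ 2 + 2 * f (.inl p.1) ^ 2) :=
      Finset.sum_le_sum fun p _ => by nlinarith [sq_nonneg (f (.inr p) - 2 * f (.inl p.1))]
    rw [Finset.sum_add_distrib, ← Finset.mul_sum, ← Finset.mul_sum] at h2
    linarith
  have hP : 0 ≤ ∑ p : {x // btau K g C x = x}, (f (.inr p) - f (.inl p.1)) ^ 2 :=
    Finset.sum_nonneg fun _ _ => sq_nonneg _
  have hT0 : 0 ≤ 1 / 2 * ∑ x, (f (.inl x) - f (.inl (btau K g C x))) ^ 2 :=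
    mul_nonneg (by norm_num) (Finset.sum_nonneg fun _ _ => sq_nonneg _)
  have hD0 : 0 ≤ ∑ v, D v := Finset.sum_nonneg fun v _ => Finset.sum_nonneg fun _ _ => sq_nonneg _
  generalize ∑ p : {x // btau K g C x = x}, (f (.inr p) - f (.inl p.1)) ^ 2 = P at *
  generalize 1 / 2 * ∑ x, (f (.inl x) - f (.inl (btau K g C x))) ^ 2 = T at *
  generalize ∑ x, (f (.inl (bsig H K x)) - f (.inl x)) ^ 2 = E at *
  generalize ∑ v, D v = DD at *
  generalize ∑ x, f (.inl x) ^ 2 = Z at *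
  generalize ∑ v, a v 4 ^ 2 = FF at *
  generalize ∑ p, f (.inr p) ^ 2 = Y at *
  have hFF : FF ≤ 400 / 7 * (T + E) := by
    have s0 := hS0 0
    have s1 := hS0 1
    have s2 := hS0 2
    have s3 := hS0 3
    have s4 := hS0 4
    have s5 := hS0 5
    have s6 := hS0 6
    linarith
  have hK : (0 : ℝ) ≤ K := Nat.cast_nonneg K
  have m1 := mul_le_mul_of_nonneg_left hFF (by linarith : (0 : ℝ) ≤ 2 * (K + 12))
  have m2 := mul_le_mul_of_nonneg_left hE (by positivity : (0 : ℝ) ≤ 2 * ((K : ℝ) + 12) ^ 2)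
  have hE0 : 0 ≤ E := hD0.trans hE
  have q1 : 0 ≤ ((K : ℝ) + 12) * P := by positivity
  have q2 : 0 ≤ ((K : ℝ) + 12) ^ 2 * P := by positivity
  have q3 : 0 ≤ ((K : ℝ) + 12) ^ 2 * T := by positivity
  nlinarith

end big

section small
variable (h : ℕ)

/-- Chords for the small graphs. -/
def stau (x : Fin (4 * h + 4)) : Fin (4 * h + 4) :=
  if h1 : x.val < h then ⟨x.val + (2 * h + 2), by omega⟩
  else if h2 : 2 * h + 2 ≤ x.val ∧ x.val < 3 * h + 2 then ⟨x.val - (2 * h + 2), by omega⟩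
  else x

lemma stau_val (x : Fin (4 * h + 4)) : (x.val < h ∧ (stau h x).val = x.val + (2 * h + 2)) ∨
    (2 * h + 2 ≤ x.val ∧ x.val < 3 * h + 2 ∧ (stau h x).val = x.val - (2 * h + 2)) ∨
    (¬ x.val < h ∧ ¬ (2 * h + 2 ≤ x.val ∧ x.val < 3 * h + 2) ∧ (stau h x).val = x.val) := by
  by_cases h1 : x.val < h
  · left; simp [stau, h1]
  · by_cases h2 : 2 * h + 2 ≤ x.val ∧ x.val < 3 * h + 2
    · right; left; simp [stau, h1, h2]
    · right; right; simp only [stau, h1, h2, dif_neg, not_false_eq_true, true_and]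

lemma srot_val (j : Fin (4 * h + 4)) :
    ((finRotate (4 * h + 4) j).val = j.val + 1 ∧ j.val < 4 * h + 3) ∨
      ((finRotate (4 * h + 4) j).val = 0 ∧ j.val = 4 * h + 3) := by
  by_cases h' : j = Fin.last (4 * h + 3)
  · right
    subst h'
    simp
  · left
    refine ⟨coe_finRotate_of_ne_last h', ?_⟩
    have := j.2
    have : j.val ≠ 4 * h + 3 := fun h'' => h' (Fin.ext h'')
    omega

lemma sadm : Adm (finRotate (4 * h + 4)) (stau h) where
  h1 x hx := by
    have := congrArg Fin.val hx
    have := srot_val h x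
    omega
  h2 x hx := by
    have := congrArg Fin.val hx
    have := srot_val h x
    have := srot_val h (finRotate (4 * h + 4) x)
    omega
  inv x := by
    ext
    have := stau_val h x
    have := stau_val h (stau h x)
    omega
  h3 x hx := by
    have := congrArg Fin.val hx
    have := srot_val h x
    have := stau_val h x
    omega

lemma sconn : (cg (finRotate (4 * h + 4)) (stau h)).Connected := by
  have key : ∀ k (hk : k < 4 * h + 4), (cg (finRotate (4 * h + 4)) (stau h)).Reachable
      (.inl ⟨0, by omega⟩) (.inl ⟨k, hk⟩) := by
    intro k
    induction k with
    | zero => intro hk; exact SimpleGraph.Reachable.refl _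
    | succ k ih =>
      intro hk
      refine (ih (by omega)).trans (SimpleGraph.Adj.reachable ?_)
      rw [cg_adj_inl (sadm h)]
      left
      congr 1
      ext
      have := srot_val h ⟨k, by omega⟩
      simp only at this ⊢
      omega
  have key2 : ∀ v, (cg (finRotate (4 * h + 4)) (stau h)).Reachable (.inl ⟨0, by omega⟩) v := by
    rintro (x | p)
    · exact key x.val x.2
    · refine (key p.1.val p.1.2).trans (SimpleGraph.Adj.reachable ?_)
      rw [SimpleGraph.adj_comm, cg_adj_inr]
  have : Nonempty (Fin (4 * h + 4) ⊕ {x // stau h x = x}) := ⟨.inl ⟨0, by omega⟩⟩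
  exact ⟨fun u v => (key2 u).symm.trans (key2 v)⟩

lemma scard [Fintype {x // stau h x = x}] : Fintype.card {x // stau h x = x} = 2 * h + 4 := by
  classical
  let A : Finset (Fin (4 * h + 4)) := Finset.univ.filter (fun x => stau h x = x)
  rw [Fintype.card_of_subtype A (by simp [A])]
  have hA : A.map Fin.valEmbedding = Finset.Ico h (2 * h + 2) ∪ Finset.Ico (3 * h + 2) (4 * h + 4) := by
    ext k
    simp only [A, Finset.mem_map, Finset.mem_filter, Finset.mem_univ, true_and,
      Fin.valEmbedding_apply, Finset.mem_union, Finset.mem_Ico]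
    constructor
    · rintro ⟨x, hx, rfl⟩
      have h1 := congrArg Fin.val hx
      have := stau_val h x
      omega
    · intro hk
      refine ⟨⟨k, by omega⟩, ?_, rfl⟩
      ext
      have := stau_val h ⟨k, by omega⟩
      simp only at this ⊢
      omega
  rw [← Finset.card_map Fin.valEmbedding, hA, Finset.card_union_of_disjoint]
  · simp; omega
  · rw [Finset.disjoint_left]
    intro k
    simp only [Finset.mem_Ico]
    omega

lemma transport {V : Type*} [Fintype V] (G : SimpleGraph V) (a b N : ℕ) (hG : Comb G a b)
    (hN : Fintype.card V = N) : ∃ G' : SimpleGraph (Fin N), Comb G' a b ∧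
      ∀ C, Poinc G C → Poinc G' C := by
  have e : Fin N ≃ V := (Fintype.equivFinOfCardEq hN).symm
  exact ⟨G.comap e, hG.comap e, fun C hC => hC.comap e⟩

lemma small_ex : ∃ G : SimpleGraph (Fin (2 * (h + 1) - 2 + 2 * (2 * (h + 1) + 2))),
    Comb G (2 * (h + 1) - 2 + (2 * (h + 1) + 2)) (2 * (h + 1) + 2) := by
  classical
  have := cg_comb (sadm h) (sconn h)
  rw [scard, Fintype.card_fin] at this
  obtain ⟨G, hG, -⟩ := transport _ _ _ (2 * (h + 1) - 2 + 2 * (2 * (h + 1) + 2)) this (by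
    rw [Fintype.card_sum, scard, Fintype.card_fin]; omega)
  refine ⟨G, ?_⟩
  convert hG using 1 <;> omega

end small

lemma quad_nn {V : Type*} [Fintype V] (G : SimpleGraph V) (f : V → ℝ) : 0 ≤ quadForm G f := by
  unfold quadForm
  refine mul_nonneg (by norm_num) (Finset.sum_nonneg fun v _ => Finset.sum_nonneg fun w _ => ?_)
  split_ifs
  · positivity
  · exact le_rfl

lemma Poinc.mono {V : Type*} [Fintype V] {G : SimpleGraph V} {C C' : ℝ} (h : Poinc G C)
    (hC : C ≤ C') : Poinc G C' := by
  obtain ⟨φ, hφ⟩ := h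
  exact ⟨φ, fun f hf => (hφ f hf).trans (mul_le_mul_of_nonneg_right hC (quad_nn G f))⟩

/-- The four generators. -/
def gens (m : ℕ) (i : ℕ) : Equiv.Perm (Tor m) :=
  if i = 0 then trX m else if i = 1 then trY m else if i = 2 then shX m else shY m

lemma big_ex (θ : ℝ) (hθ : 0 < θ) (K : ℕ) (hK : (K : ℝ) ≤ 4 * θ) (m g n : ℕ) (hm : 1 ≤ m)
    (h1 : 4 * m ^ 2 + 1 ≤ g) (h2 : g ≤ 6 * m ^ 2 + 1) (hn : n + 2 * g = (K + 12) * m ^ 2 + 2) :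
    ∃ G : SimpleGraph (Fin (2 * g - 2 + 2 * n)), Comb G (2 * g - 2 + n) n ∧
      Poinc G (648 * (θ + 4) ^ 2) := by
  classical
  haveI : NeZero m := ⟨by omega⟩
  obtain ⟨q, rfl⟩ : ∃ q, g = 4 * m ^ 2 + 1 + q := ⟨g - (4 * m ^ 2 + 1), by omega⟩
  have hT : Fintype.card (Tor m) = m ^ 2 := by
    rw [Fintype.card_prod, ZMod.card, sq]
  obtain ⟨C, hC, hCq⟩ := Finset.exists_subset_card_eq
    (s := (Finset.univ : Finset (Tor m)) ×ˢ ({8, 9} : Finset ℕ)) (n := q) (by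
      rw [Finset.card_product, Finset.card_univ, hT, Finset.card_pair (by norm_num)]; omega)
  have hC' : ∀ x ∈ C, x.2 = 8 ∨ x.2 = 9 := by
    intro x hx
    have := hC hx
    simpa using this
  have hcard := bcard (K := K) (g := gens m) hC'
  rw [hT, hCq] at hcard
  let φ : ((Tor m × Fin (K + 12)) ⊕ {x // btau K (gens m) C x = x} → ℝ) →ₗ[ℝ] ℝ :=
    ∑ v : Tor m, LinearMap.proj (.inl (v, ⟨4, by omega⟩))
  have hφ : ∀ f, φ f = ∑ v : Tor m, f (.inl (v, ⟨4, by omega⟩)) := by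
    intro f
    simp only [φ, LinearMap.sum_apply, LinearMap.proj_apply]
  have hP : ∀ f, φ f = 0 → lapNormSq (cg (bsig (Tor m) K) (btau K (gens m) C)) f ≤
      (4000 / 7 * (K + 12) + 10 * (K + 12) ^ 2 + 2) *
        quadForm (cg (bsig (Tor m) K) (btau K (gens m) C)) f := by
    intro f hf
    rw [hφ] at hf
    refine bpoinc (fun F hF => ?_) f hf
    have := torus_gap F hF
    have e0 : gens m 0 = trX m := rfl
    have e1 : gens m 1 = trY m := rfl
    have e2 : gens m 2 = shX m := rfl
    have e3 : gens m 3 = shY m := rfl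
    rw [e0, e1, e2, e3]
    exact this
  haveI : Nonempty ((Tor m × Fin (K + 12)) ⊕ {x // btau K (gens m) C x = x}) :=
    ⟨.inl (0, ⟨4, by omega⟩)⟩
  have hd : ∀ v, degN (cg (bsig (Tor m) K) (btau K (gens m) C)) v = 1 ∨
      degN (cg (bsig (Tor m) K) (btau K (gens m) C)) v = 3 := by
    rintro (x | p)
    · exact Or.inr (degN_inl badm x)
    · exact Or.inl (degN_inr p)
  have hconn := conn_of_poinc _ hd _ φ hP (by
    rw [hφ]
    simp only [Finset.sum_const, Finset.card_univ, hT, nsmul_eq_mul, mul_one]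
    positivity)
  have hcomb := cg_comb badm hconn
  have hX : Fintype.card (Tor m × Fin (K + 12)) = m ^ 2 * (K + 12) := by
    rw [Fintype.card_prod, hT, Fintype.card_fin]
  have hcm : m ^ 2 * (K + 12) = (K + 12) * m ^ 2 := mul_comm _ _
  have ha : Fintype.card (Tor m × Fin (K + 12)) = 2 * (4 * m ^ 2 + 1 + q) - 2 + n := by
    rw [hX]; omega
  have hb : Fintype.card {x // btau K (gens m) C x = x} = n := by omega
  rw [ha, hb] at hcomb
  obtain ⟨G, hG, hGP⟩ := transport _ _ _ (2 * (4 * m ^ 2 + 1 + q) - 2 + 2 * n) hcomb (by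
    rw [Fintype.card_sum, ha, hb]; omega)
  refine ⟨G, hG, (hGP _ ⟨φ, hP⟩).mono ?_⟩
  have hK0 : (0 : ℝ) ≤ K := Nat.cast_nonneg K
  have : ((K : ℝ) / 4 + 4) ^ 2 ≤ (θ + 4) ^ 2 := by
    apply pow_le_pow_left₀ <;> linarith
  nlinarith

lemma asym (c : ℝ) (hc : 0 < c) :
    Filter.Tendsto (fun g : ℕ => ((⌊√(c * g)⌋₊ : ℝ)) ^ 2 / g) Filter.atTop (nhds c) := by
  have h1 : Filter.Tendsto (fun g : ℕ => √(c * g)) Filter.atTop Filter.atTop :=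
    Real.tendsto_sqrt_atTop.comp
      (Filter.Tendsto.const_mul_atTop hc tendsto_natCast_atTop_atTop)
  have h2 := (tendsto_nat_floor_div_atTop (R := ℝ)).comp h1
  have h3 := (h2.pow 2).const_mul c
  simp only [one_pow, mul_one] at h3
  refine h3.congr' ?_
  filter_upwards [Filter.eventually_gt_atTop 0] with g hg
  have hg' : (0 : ℝ) < g := by exact_mod_cast hg
  simp only [Function.comp]
  rw [div_pow, Real.sq_sqrt (by positivity)]
  field_simp

lemma exg (θ : ℝ) (hθ : 0 < θ) (K : ℕ) (hK : (K : ℝ) ≤ 4 * θ) (m g : ℕ) :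
    ∃ n : ℕ, 0 < n ∧ ∃ G : SimpleGraph (Fin (2 * g - 2 + 2 * n)),
      (1 ≤ g → Comb G (2 * g - 2 + n) n) ∧
      ((1 ≤ m ∧ 4 * m ^ 2 + 1 ≤ g ∧ g ≤ 6 * m ^ 2 + 1 ∧ 2 * g < (K + 12) * m ^ 2 + 2) →
        n + 2 * g = (K + 12) * m ^ 2 + 2 ∧ Poinc G (648 * (θ + 4) ^ 2)) := by
  by_cases hgood : 1 ≤ m ∧ 4 * m ^ 2 + 1 ≤ g ∧ g ≤ 6 * m ^ 2 + 1 ∧ 2 * g < (K + 12) * m ^ 2 + 2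
  · obtain ⟨hm, h1, h2, h3⟩ := hgood
    obtain ⟨n, hn⟩ : ∃ n, n + 2 * g = (K + 12) * m ^ 2 + 2 :=
      ⟨(K + 12) * m ^ 2 + 2 - 2 * g, by omega⟩
    obtain ⟨G, hG, hP⟩ := big_ex θ hθ K hK m g n hm h1 h2 hn
    exact ⟨n, by omega, G, fun _ => hG, fun _ => ⟨hn, hP⟩⟩
  · rcases Nat.eq_zero_or_pos g with rfl | hg
    · exact ⟨1, one_pos, ⊥, fun h => by omega, fun h => absurd h hgood⟩
    · obtain ⟨h, rfl⟩ : ∃ h, g = h + 1 := ⟨g - 1, by omega⟩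
      obtain ⟨G, hG⟩ := small_ex h
      exact ⟨2 * (h + 1) + 2, by omega, G, fun _ => hG, fun h => absurd h hgood⟩

lemma good_ev (θ : ℝ) (hθ : 0 < θ) (K : ℕ) (hK : (K : ℝ) ≤ 4 * θ) (hK' : 4 * θ < K + 1)
    (m : ℕ → ℕ) (hm : Filter.Tendsto (fun g : ℕ => ((m g : ℝ)) ^ 2 / g) Filter.atTop
      (nhds ((2 + θ) / (K + 12)))) :
    ∀ᶠ g in Filter.atTop, 1 ≤ m g ∧ 4 * m g ^ 2 + 1 ≤ g ∧ g ≤ 6 * m g ^ 2 + 1 ∧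
      2 * g < (K + 12) * m g ^ 2 + 2 := by
  have hL : (0 : ℝ) < K + 12 := by positivity
  have c1 : (1 : ℝ) / 6 < (2 + θ) / (K + 12) := by
    rw [div_lt_div_iff₀ (by norm_num) hL]; linarith
  have c2 : 4 * ((2 + θ) / (K + 12)) + 0 < 1 := by
    rw [add_zero, ← mul_div_assoc, div_lt_one hL]; linarith
  have c3 : 2 / ((K : ℝ) + 12) < (2 + θ) / (K + 12) := by
    rw [div_lt_div_iff_of_pos_right hL]; linarith
  have t2 := (hm.const_mul 4).add (tendsto_one_div_atTop_nhds_zero_nat (𝕜 := ℝ))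
  filter_upwards [hm.eventually_const_lt c1, hm.eventually_const_lt c3,
    t2.eventually_lt_const c2, Filter.eventually_gt_atTop 0] with g e1 e3 e2 hg
  have hg' : (0 : ℝ) < g := by exact_mod_cast hg
  rw [lt_div_iff₀ hg'] at e1
  rw [div_lt_div_iff₀ hL hg'] at e3
  rw [← mul_div_assoc, ← add_div, div_lt_one hg'] at e2
  have e2' : 4 * m g ^ 2 + 1 < g := by exact_mod_cast e2
  have e1' : (g : ℝ) < ((6 * m g ^ 2 : ℕ) : ℝ) := by push_cast; linarith
  have e1'' : g < 6 * m g ^ 2 := by exact_mod_cast e1'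
  have e3' : (2 * g : ℝ) < (K + 12) * (m g : ℝ) ^ 2 := by linarith
  have e3'' : 2 * g < (K + 12) * m g ^ 2 := by exact_mod_cast e3'
  refine ⟨?_, by omega, by omega, by omega⟩
  by_contra h0
  have : m g = 0 := by omega
  rw [this] at e1''
  simp at e1''

end Aux

open Filter in
/-- For any `θ > 0` there is a function `n : ℤ⁺ → ℤ⁺` and a sequence of finite connected
graphs `G_g` with all vertex degrees 1 or 3, having `2g - 2 + n(g)` vertices of degree 3
and `n(g)` vertices of degree 1, with `n(g)/g → θ` and
`liminf λ₁(G_g) ≥ 1/(648(θ+4)²)`. -/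
theorem stmt18 (θ : ℝ) (hθ : 0 < θ) :
    ∃ n : ℕ → ℕ, (∀ g, 0 < n g) ∧
    ∃ G : (g : ℕ) → SimpleGraph (Fin (2 * g - 2 + 2 * n g)),
      (∀ g, 1 ≤ g →
        (G g).Connected ∧
        (∀ v, degN (G g) v = 1 ∨ degN (G g) v = 3) ∧
        {v | degN (G g) v = 3}.ncard = 2 * g - 2 + n g ∧
        {v | degN (G g) v = 1}.ncard = n g) ∧
      Tendsto (fun g => (n g : ℝ) / (g : ℝ)) atTop (nhds θ) ∧
      1 / (648 * (θ + 4) ^ 2) ≤ atTop.liminf (fun g => lapEig (G g) 1) := by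
  classical
  have hK : ((⌊4 * θ⌋₊ : ℕ) : ℝ) ≤ 4 * θ := Nat.floor_le (by positivity)
  have hK' : 4 * θ < ((⌊4 * θ⌋₊ : ℕ) : ℝ) + 1 := Nat.lt_floor_add_one _
  generalize ⌊4 * θ⌋₊ = K at hK hK'
  have hL : (0 : ℝ) < (K : ℝ) + 12 := by positivity
  obtain ⟨m, hm⟩ : ∃ m : ℕ → ℕ, Filter.Tendsto (fun g : ℕ => ((m g : ℝ)) ^ 2 / g) Filter.atTop
      (nhds ((2 + θ) / (K + 12))) := 
    ⟨fun g => ⌊√((2 + θ) / ((K : ℝ) + 12) * (g : ℝ))⌋₊, asym _ (by positivity)⟩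
  have hev := good_ev θ hθ K hK hK' m hm
  choose n hn G hG hgood using fun g => exg θ hθ K hK (m g) g
  refine ⟨n, hn, G, fun g hg => hG g hg, ?_, ?_⟩
  · have t := ((hm.const_mul ((K : ℝ) + 12)).add
      ((tendsto_one_div_atTop_nhds_zero_nat (𝕜 := ℝ)).const_mul 2)).sub_const 2
    have e : ((K : ℝ) + 12) * ((2 + θ) / (K + 12)) + 2 * 0 - 2 = θ := by
      field_simp; ring
    rw [e] at t
    refine t.congr' ?_
    filter_upwards [hev, Filter.eventually_gt_atTop 0] with g h hg
    have hg' : (g : ℝ) ≠ 0 := by positivity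
    have h1 := (hgood g h).1
    have h2 : (n g : ℝ) + 2 * g = (K + 12) * (m g : ℝ) ^ 2 + 2 := by exact_mod_cast h1
    have h3 : (n g : ℝ) = (K + 12) * (m g : ℝ) ^ 2 + 2 - 2 * g := by linarith
    rw [h3]
    field_simp
  · have hb : ∀ᶠ g in Filter.atTop, 1 / (648 * (θ + 4) ^ 2) ≤ lapEig (G g) 1 ∧
        lapEig (G g) 1 ≤ 2 := by
      filter_upwards [hev, Filter.eventually_ge_atTop 1] with g h hg
      refine lapEig_bounds (G g) (hG g hg).2.1 ?_ _ (by positivity) (hgood g h).2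
      rw [Fintype.card_fin]
      have := hn g
      omega
    refine Filter.le_liminf_of_le ?_ (hb.mono fun g h => h.1)
    exact Filter.IsBoundedUnder.isCoboundedUnder_ge ⟨2, by
      rw [Filter.eventually_map]; exact hb.mono fun g h => h.2⟩
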